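/- Let β_1, β_2, β_3, … be rational numbers such that β_1 = 1, β_2 = 5/2, and for all i ≥ 3 both: β_i ≥ β_{i−1} + 2, and for all s, t ∈ {2, …, i−2} with s + t = i we have β_i ≥ β_s + β_t + (2i−1)/i. Let α ≥ 1 be an integer and let G be a graph on n vertices with independence number at most α. Then G contains an immersion of a complete graph on at least ⌊n/β_α⌋ − 1 vertices. -/

import Mathlib

/-- `G` contains an immersion of a complete graph on `k` vertices: there are `k`
distinct branch vertices `φ u`, and for every pair `u < v` (i.e. every edge of `K_k`)
a path `P u v` joining `φ u` and `φ v`, the paths being pairwise edge-disjoint. -/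
def CliqueImmersion {V : Type*} (G : SimpleGraph V) (k : ℕ) : Prop :=
  ∃ (φ : Fin k → V) (P : ∀ u v : Fin k, G.Walk (φ u) (φ v)),
    Function.Injective φ ∧
    (∀ u v : Fin k, u < v → (P u v).IsPath) ∧
    (∀ u v u' v' : Fin k, u < v → u' < v' → (u, v) ≠ (u', v') →
      ∀ e ∈ (P u v).edges, e ∉ (P u' v').edges)

namespace CI
open Classical

/-- The subgraph of edges inside `S` having colour `d`. -/
def Gr {V : Type*} (G : SimpleGraph V) (c : Sym2 V → Sym2 V) (S : Finset V) (d : Sym2 V) :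
    SimpleGraph V where
  Adj a b := G.Adj a b ∧ a ∈ S ∧ b ∈ S ∧ c s(a, b) = d
  symm := ⟨fun a b h => ⟨h.1.symm, h.2.2.1, h.2.1, by rw [Sym2.eq_swap]; exact h.2.2.2⟩⟩
  loopless := ⟨fun a h => G.loopless.irrefl a h.1⟩

/-- Immersion inside `S` with branch set `B`. -/
def Imm {V : Type*} (G : SimpleGraph V) (S B : Finset V) : Prop :=
  ∃ c : Sym2 V → Sym2 V, ∀ u ∈ B, ∀ v ∈ B, u ≠ v → (Gr G c S s(u, v)).Reachable u v

def HasImm {V : Type*} (G : SimpleGraph V) (S : Finset V) (k : ℕ) : Prop :=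
  ∃ B ⊆ S, B.card = k ∧ Imm G S B

def AlphaLe {V : Type*} (G : SimpleGraph V) (S : Finset V) (a : ℕ) : Prop :=
  ∀ I ⊆ S, (I : Set V).Pairwise (fun x y => ¬ G.Adj x y) → I.card ≤ a

variable {V : Type*} {G : SimpleGraph V}

lemma Imm.mono {G' : SimpleGraph V} {S S' B B' : Finset V} (h : Imm G S B) (hG : G ≤ G')
    (hS : S ⊆ S') (hB : B' ⊆ B) : Imm G' S' B' := by
  obtain ⟨c, hc⟩ := h
  refine ⟨c, fun u hu v hv huv => (hc u (hB hu) v (hB hv) huv).mono ?_⟩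
  intro a b hab
  exact ⟨hG hab.1, hS hab.2.1, hS hab.2.2.1, hab.2.2.2⟩

lemma HasImm.mono {G' : SimpleGraph V} {S S' : Finset V} {k k' : ℕ} (h : HasImm G S k)
    (hG : G ≤ G') (hS : S ⊆ S') (hk : k' ≤ k) : HasImm G' S' k' := by
  obtain ⟨B, hB, hBk, hi⟩ := h
  obtain ⟨B', hB', hc⟩ := Finset.exists_subset_card_eq (hk.trans hBk.ge)
  exact ⟨B', hB'.trans (hB.trans hS), hc, hi.mono hG hS hB'⟩

lemma AlphaLe.mono {S S' : Finset V} {a a' : ℕ} (h : AlphaLe G S a)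
    (hS : S' ⊆ S) (ha : a ≤ a') : AlphaLe G S' a' :=
  fun I hI hp => (h I (hI.trans hS) hp).trans ha

lemma HasImm.zero (S : Finset V) : HasImm G S 0 :=
  ⟨∅, by simp, by simp, id, by simp⟩

lemma clique_imm {S : Finset V} (h : ∀ u ∈ S, ∀ v ∈ S, u ≠ v → G.Adj u v) : HasImm G S S.card := by
  refine ⟨S, subset_rfl, rfl, id, fun u hu v hv huv => SimpleGraph.Adj.reachable ?_⟩
  exact ⟨h u hu v hv huv, hu, hv, rfl⟩

lemma clique_of_alpha_one {S : Finset V} (h : AlphaLe G S 1) :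
    ∀ u ∈ S, ∀ v ∈ S, u ≠ v → G.Adj u v := by
  intro u hu v hv huv
  by_contra hn
  have := h {u, v} (by intro x; simp; rintro (rfl | rfl) <;> assumption) (by
    intro x hx y hy hxy
    simp at hx hy
    rcases hx with rfl | rfl <;> rcases hy with rfl | rfl <;> simp_all [G.adj_comm])
  rw [Finset.card_pair huv] at this
  omega

lemma HasImm.toClique {S : Finset V} {k : ℕ} (h : HasImm G S k) :
    ∃ (φ : Fin k → V) (P : ∀ u v : Fin k, G.Walk (φ u) (φ v)),
    Function.Injective φ ∧
    (∀ u v : Fin k, u < v → (P u v).IsPath) ∧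
    (∀ u v u' v' : Fin k, u < v → u' < v' → (u, v) ≠ (u', v') →
      ∀ e ∈ (P u v).edges, e ∉ (P u' v').edges) := by
  obtain ⟨B, hB, hBk, c, hc⟩ := h
  let e := (B.equivFinOfCardEq hBk).symm
  have key : ∀ u v : Fin k, ∃ p : G.Walk (e u : V) (e v), p.IsPath ∧
      ∀ d ∈ p.edges, c d = s((e u : V), (e v : V)) := by
    intro u v
    by_cases huv : u = v
    · subst huv
      exact ⟨.nil, by simp, by simp⟩
    · have hr := hc (e u) (e u).2 (e v) (e v).2 (by
        intro h; exact huv (e.injective (Subtype.ext h)))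
      obtain ⟨p, hp⟩ := hr.exists_isPath
      have hle : Gr G c S s((e u : V), (e v : V)) ≤ G := fun a b h => h.1
      refine ⟨p.mapLe hle, hp.mapLe hle, ?_⟩
      intro d hd
      rw [SimpleGraph.Walk.edges_mapLe_eq_edges] at hd
      have := p.edges_subset_edgeSet hd
      induction d with
      | h a b => exact this.2.2.2
  choose P hP1 hP2 using key
  refine ⟨fun u => e u, P, fun u v h => e.injective (Subtype.ext h), fun u v _ => hP1 u v, ?_⟩
  intro u v u' v' h1 h2 hne d hd hd'
  have := (hP2 _ _ d hd).symm.trans (hP2 _ _ d hd')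
  rw [Sym2.eq_iff] at this
  have inj : ∀ a b, (e a : V) = e b → a = b := fun a b h => e.injective (Subtype.ext h)
  rcases this with ⟨h, h'⟩ | ⟨h, h'⟩
  · exact hne (by rw [inj _ _ h, inj _ _ h'])
  · have := inj _ _ h; have := inj _ _ h'; subst_vars; exact absurd h1 (by omega)

lemma hall_on (D : Finset V) (t : V → Finset V) (h : ∀ s ⊆ D, s.card ≤ (s.biUnion t).card) :
    ∃ f : V → V, Set.InjOn f D ∧ ∀ v ∈ D, f v ∈ t v := by
  have := (Finset.all_card_le_biUnion_card_iff_exists_injective (fun v : D => t v)).1 (by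
    intro s
    have h1 := h (s.map (Function.Embedding.subtype _)) (by
      intro v; simp; intro h _; exact h)
    rw [Finset.card_map] at h1
    refine h1.trans (Finset.card_le_card ?_)
    intro v; simp)
  obtain ⟨f, hf, hf'⟩ := this
  refine ⟨fun v => if h : v ∈ D then f ⟨v, h⟩ else v, ?_, ?_⟩
  · intro u hu v hv huv
    have hu' : u ∈ D := hu
    have hv' : v ∈ D := hv
    simp only [hu', hv', dif_pos] at huv
    simpa using hf huv
  · intro v hv
    simp only [hv, dif_pos]
    exact hf' ⟨v, hv⟩

lemma recolor (c : Sym2 V → Sym2 V) (I : Finset V) (g : V → V → Sym2 V) (d : Sym2 V) :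
    ∃ c' : Sym2 V → Sym2 V, (∀ w z, w ∉ I → z ∈ I → c' s(w, z) = g w z) ∧
      (∀ w z, w ∉ I → z ∉ I → c' s(w, z) = c s(w, z)) ∧
      (∀ w z, w ∈ I → z ∈ I → c' s(w, z) = d) := by
  refine ⟨Sym2.lift ⟨fun a b => if a ∈ I then (if b ∈ I then d else g b a) else
    (if b ∈ I then g a b else c s(a, b)), ?_⟩, ?_, ?_, ?_⟩
  · intro a b
    by_cases ha : a ∈ I <;> by_cases hb : b ∈ I <;> simp [ha, hb, Sym2.eq_swap]
  all_goals intro w z hw hz; simp [hw, hz]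

/-- chains along a partial injection -/
lemma chain_own [Finite V] (D A : Finset V) (f : V → V) (hf : Set.InjOn f D)
    (hA : ∀ v ∈ D, f v ∉ A) :
    ∃ own : V → V, ∀ a ∈ A,
      (∀ w, Relation.ReflTransGen (fun v w => v ∈ D ∧ w = f v) a w → own w = a) ∧
      ∃ w, w ∉ D ∧ Relation.ReflTransGen (fun v w => v ∈ D ∧ w = f v) a w := by
  set r := fun v w => v ∈ D ∧ w = f v with hr
  have uniq : ∀ a w, Relation.ReflTransGen r a w → a ∈ A → ∀ a' ∈ A,
      Relation.ReflTransGen r a' w → a' = a := by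
    intro a w h
    induction h with
    | refl =>
      intro ha a' ha' h'
      rcases Relation.ReflTransGen.cases_tail h' with h | ⟨v, _, hv⟩
      · exact h.symm
      · exact absurd ha (hv.2 ▸ hA v hv.1)
    | tail h1 h2 ih =>
      rename_i v w
      intro ha a' ha' h'
      rcases Relation.ReflTransGen.cases_tail h' with h | ⟨v', hv'1, hv'⟩
      · subst h
        exact absurd ha' (h2.2 ▸ hA v h2.1)
      · have : v' = v := hf hv'.1 h2.1 (hv'.2.symm.trans h2.2)
        subst this
        exact ih ha a' ha' hv'1
  refine ⟨fun w => if h : ∃ a ∈ A, Relation.ReflTransGen r a w then h.choose else w, ?_⟩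
  intro a ha
  constructor
  · intro w hw
    have h : ∃ a ∈ A, Relation.ReflTransGen r a w := ⟨a, ha, hw⟩
    simp only [h, dif_pos]
    exact uniq a w hw ha _ h.choose_spec.1 h.choose_spec.2
  · by_contra hcon
    push Not at hcon
    let C := {w | Relation.ReflTransGen r a w}
    have hCD : ∀ w ∈ C, w ∈ D := by
      intro w hw
      by_contra h
      exact hcon w h hw
    have hmap : Set.MapsTo f C C := fun w hw => Relation.ReflTransGen.tail hw ⟨hCD w hw, rfl⟩
    have hinj : Set.InjOn f C := fun u hu v hv h => hf (hCD u hu) (hCD v hv) h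
    have hsurj := Finite.surjective_of_injective ((hmap.restrict_inj).2 hinj)
    obtain ⟨⟨v, hv⟩, hva'⟩ := hsurj ⟨a, (show a ∈ C from Relation.ReflTransGen.refl)⟩
    have hva : f v = a := congrArg Subtype.val hva'
    exact hA v (hCD v hv) (hva ▸ ha)

lemma extend_one [Finite V] (S I B : Finset V) (x : V) (hIS : I ⊆ S) (hB : B ⊆ S \ I) (hx : x ∈ I)
    (him : Imm G (S \ I) B) (hdom : ∀ v ∈ S \ I, ∃ z ∈ I, G.Adj v z)
    (hcut : ∀ J ⊆ I, J.Nonempty → x ∉ J →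
      (B.filter (fun v => ∀ z ∈ I, G.Adj v z → z ∈ J)).card ≤
      (((S \ I) \ B).filter (fun v => (∃ z ∈ J, G.Adj v z) ∧ ∃ z ∈ I \ J, G.Adj v z)).card) :
    Imm G S (insert x B) := by
  let D := (S \ I).filter (fun v => ¬ G.Adj v x)
  let t : V → Finset V := fun v => ((S \ I) \ B).filter (fun w => ∃ z ∈ I, G.Adj v z ∧ G.Adj w z)
  obtain ⟨f, hf, hft⟩ := hall_on D t (by
    intro s hs
    rcases s.eq_empty_or_nonempty with rfl | hne
    · simp
    let J := I.filter (fun z => ∃ v ∈ s, G.Adj v z)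
    have hJne : J.Nonempty := by
      obtain ⟨v, hv⟩ := hne
      obtain ⟨z, hz, hz'⟩ := hdom v (Finset.mem_filter.1 (hs hv)).1
      exact ⟨z, Finset.mem_filter.2 ⟨hz, v, hv, hz'⟩⟩
    have hxJ : x ∉ J := by
      intro h
      obtain ⟨_, v, hv, hv'⟩ := Finset.mem_filter.1 h
      exact (Finset.mem_filter.1 (hs hv)).2 hv'
    have hc := hcut J (Finset.filter_subset _ _) hJne hxJ
    let N := ((S \ I) \ B).filter (fun v => ∀ z ∈ I, G.Adj v z → z ∈ J)
    have h1 : s ⊆ B.filter (fun v => ∀ z ∈ I, G.Adj v z → z ∈ J) ∪ N := by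
      intro v hv
      have hvS := (Finset.mem_filter.1 (hs hv)).1
      have hvJ : ∀ z ∈ I, G.Adj v z → z ∈ J := fun z hz h =>
        Finset.mem_filter.2 ⟨hz, v, hv, h⟩
      by_cases hvB : v ∈ B
      · exact Finset.mem_union_left _ (Finset.mem_filter.2 ⟨hvB, hvJ⟩)
      · exact Finset.mem_union_right _ (Finset.mem_filter.2 ⟨Finset.mem_sdiff.2 ⟨hvS, hvB⟩, hvJ⟩)
    have hdis : Disjoint (((S \ I) \ B).filter
        (fun v => (∃ z ∈ J, G.Adj v z) ∧ ∃ z ∈ I \ J, G.Adj v z)) N := by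
      rw [Finset.disjoint_left]
      intro v hv hvN
      obtain ⟨_, _, z, hz, hvz⟩ := Finset.mem_filter.1 hv
      have hz := Finset.mem_sdiff.1 hz
      exact hz.2 ((Finset.mem_filter.1 hvN).2 z hz.1 hvz)
    have hQ : ∀ w ∈ (S \ I) \ B, (∃ z ∈ J, G.Adj w z) → w ∈ s.biUnion t := by
      rintro w hw ⟨z, hz, hwz⟩
      obtain ⟨hzI, v, hv, hvz⟩ := Finset.mem_filter.1 hz
      exact Finset.mem_biUnion.2 ⟨v, hv, Finset.mem_filter.2 ⟨hw, z, hzI, hvz, hwz⟩⟩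
    have h2 : (((S \ I) \ B).filter
        (fun v => (∃ z ∈ J, G.Adj v z) ∧ ∃ z ∈ I \ J, G.Adj v z)) ∪ N ⊆ s.biUnion t := by
      intro w hw
      rcases Finset.mem_union.1 hw with h | h
      · obtain ⟨h, h', _⟩ := Finset.mem_filter.1 h
        exact hQ w h h'
      · obtain ⟨h, h'⟩ := Finset.mem_filter.1 h
        obtain ⟨z, hz, hwz⟩ := hdom w (Finset.mem_sdiff.1 h).1
        exact hQ w h ⟨z, h' z hz hwz, hwz⟩
    have h3 := Finset.card_le_card h1
    have h4 := Finset.card_le_card h2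
    rw [Finset.card_union_of_disjoint hdis] at h4
    have h5 := Finset.card_union_le (B.filter (fun v => ∀ z ∈ I, G.Adj v z → z ∈ J)) N
    omega)
  have hfm : ∀ v ∈ D, f v ∈ S \ I ∧ f v ∉ B ∧ ∃ z ∈ I, G.Adj v z ∧ G.Adj (f v) z := by
    intro v hv
    obtain ⟨h1, h2⟩ := Finset.mem_filter.1 (hft v hv)
    exact ⟨(Finset.mem_sdiff.1 h1).1, (Finset.mem_sdiff.1 h1).2, h2⟩
  obtain ⟨own, hown⟩ := chain_own D B f hf (fun v hv => (hfm v hv).2.1)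
  obtain ⟨c, hc⟩ := him
  obtain ⟨c', hc1, hc2, -⟩ := recolor c I (fun w _ => s(own w, x)) s(x, x)
  have toX : ∀ b ∈ B, (Gr G c' S s(b, x)).Reachable b x := by
    intro b hb
    obtain ⟨h1, w, hwD, hw⟩ := hown b hb
    have edge : ∀ w z, w ∈ S \ I → z ∈ I → G.Adj w z → own w = b →
        (Gr G c' S s(b, x)).Adj w z := by
      intro w z hw hz hwz ho
      have hw := Finset.mem_sdiff.1 hw
      exact ⟨hwz, hw.1, hIS hz, by rw [hc1 w z hw.2 hz, ho]⟩
    have main : ∀ w, Relation.ReflTransGen (fun v w => v ∈ D ∧ w = f v) b w →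
        w ∈ S \ I ∧ (Gr G c' S s(b, x)).Reachable b w := by
      intro w hw
      induction hw with
      | refl => exact ⟨hB hb, .refl _⟩
      | tail h2 h3 ih =>
        rename_i v w
        have h3' := h3
        obtain ⟨hvD, rfl⟩ := h3
        obtain ⟨hs, -, z, hz, hvz, hwz⟩ := hfm v hvD
        refine ⟨hs, ih.2.trans ?_⟩
        exact (edge v z ih.1 hz hvz (h1 _ h2)).reachable.trans
          (edge (f v) z hs hz hwz (h1 _ (h2.tail h3'))).symm.reachable
    obtain ⟨hwS, hwr⟩ := main w hw
    have hwx : G.Adj w x := by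
      by_contra h
      exact hwD (Finset.mem_filter.2 ⟨hwS, h⟩)
    exact hwr.trans (edge w x hwS hx hwx (h1 w hw)).reachable
  refine ⟨c', ?_⟩
  intro u hu v hv huv
  rcases Finset.mem_insert.1 hu with rfl | hu'
  · rcases Finset.mem_insert.1 hv with rfl | hv
    · exact absurd rfl huv
    · rw [Sym2.eq_swap]; exact (toX v hv).symm
  · rcases Finset.mem_insert.1 hv with rfl | hv
    · exact toX u hu'
    · refine (hc u hu' v hv huv).mono ?_
      intro a b hab
      have ha := Finset.mem_sdiff.1 hab.2.1
      have hb := Finset.mem_sdiff.1 hab.2.2.1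
      exact ⟨hab.1, ha.1, hb.1, by rw [hc2 a b ha.2 hb.2]; exact hab.2.2.2⟩

lemma noNbr {S I C : Finset V} {i : ℕ} (h : AlphaLe G S i) (hIS : I ⊆ S)
    (hI : (I : Set V).Pairwise (fun x y => ¬ G.Adj x y)) (hC : C ⊆ I) :
    AlphaLe G ((S \ C).filter (fun v => ∀ z ∈ C, ¬ G.Adj v z)) (i - C.card) := by
  intro K hK hp
  have hK' : ∀ v ∈ K, v ∈ S ∧ v ∉ C ∧ ∀ z ∈ C, ¬ G.Adj v z := by
    intro v hv
    have := hK hv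
    simpa [and_assoc] using this
  have hdis : Disjoint K C := Finset.disjoint_left.2 fun v hv => (hK' v hv).2.1
  have := h (K ∪ C) (by
    intro v hv
    rcases Finset.mem_union.1 hv with h | h
    · exact (hK' v h).1
    · exact hIS (hC h)) (by
    intro u hu v hv huv
    simp only [Finset.coe_union, Set.mem_union, Finset.mem_coe] at hu hv
    rcases hu with hu | hu <;> rcases hv with hv | hv
    · exact hp hu hv huv
    · exact (hK' u hu).2.2 v hv
    · exact fun h => (hK' v hv).2.2 u hu h.symm
    · exact hI (hC hu) (hC hv) huv)
  rw [Finset.card_union_of_disjoint hdis] at this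
  omega

lemma step_general [Finite V] (β : ℕ → ℚ)
    (hstep : ∀ i : ℕ, 3 ≤ i → β (i - 1) + 2 ≤ β i)
    (hsplit : ∀ i : ℕ, 3 ≤ i → ∀ s t : ℕ, 2 ≤ s → s ≤ i - 2 → 2 ≤ t → t ≤ i - 2 →
      s + t = i → β s + β t + (2 * (i : ℚ) - 1) / (i : ℚ) ≤ β i)
    (i k : ℕ) (hi : 3 ≤ i) (S I B : Finset V) (hα : AlphaLe G S i)
    (hcard : β i * (k + 2) ≤ S.card) (hIS : I ⊆ S)
    (hI : (I : Set V).Pairwise (fun x y => ¬ G.Adj x y)) (hIc : I.card = i)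
    (hB : B ⊆ S \ I) (hBk : B.card = k) (him : Imm G (S \ I) B)
    (hsmall : ∀ s, 1 ≤ s → s < i → ∀ T ⊆ S, AlphaLe G T s → (T.card : ℚ) ≤ β s * (k + 2))
    (hclq : ∀ T ⊆ S, AlphaLe G T 1 → T.card ≤ k) : HasImm G S (k + 1) := by
  have hIne : I.Nonempty := by rw [← Finset.card_pos]; omega
  obtain ⟨x, hx⟩ := hIne
  have hxB : x ∉ B := fun h => (Finset.mem_sdiff.1 (hB h)).2 hx
  refine ⟨insert x B, ?_, by rw [Finset.card_insert_of_notMem hxB, hBk], ?_⟩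
  · intro v hv
    rcases Finset.mem_insert.1 hv with rfl | h
    · exact hIS hx
    · exact (Finset.mem_sdiff.1 (hB h)).1
  apply extend_one S I B x hIS hB hx him
  · intro v hv
    by_contra hcon
    push Not at hcon
    obtain ⟨hvS, hvI⟩ := Finset.mem_sdiff.1 hv
    have h1 := noNbr hα hIS hI (subset_refl I)
    have h2 := h1 {v} (by
      intro w hw
      rw [Finset.mem_singleton.1 hw]
      exact Finset.mem_filter.2 ⟨hv, hcon⟩) (by simp)
    simp [hIc] at h2
  · intro J hJ hJne hxJ
    set C := I \ J with hC
    have hCI : C ⊆ I := Finset.sdiff_subset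
    have hxC : x ∈ C := Finset.mem_sdiff.2 ⟨hx, hxJ⟩
    set NC := (S \ C).filter (fun v => ∀ z ∈ C, ¬ G.Adj v z) with hNC
    set NJ := (S \ J).filter (fun v => ∀ z ∈ J, ¬ G.Adj v z) with hNJ
    have hNCS : NC ⊆ S := (Finset.filter_subset _ _).trans Finset.sdiff_subset
    have hNJS : NJ ⊆ S := (Finset.filter_subset _ _).trans Finset.sdiff_subset
    have haC := noNbr hα hIS hI hCI
    have haJ := noNbr hα hIS hI hJ
    have hCJ : C.card + J.card = i := by
      rw [hC, Finset.card_sdiff_add_card_eq_card hJ, hIc]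
    have hJ1 : 1 ≤ J.card := Finset.card_pos.2 hJne
    have hC1 : 1 ≤ C.card := Finset.card_pos.2 ⟨x, hxC⟩
    rw [show i - C.card = J.card by omega] at haC
    rw [show i - J.card = C.card by omega] at haJ
    have cover : S ⊆ (NC ∪ NJ) ∪ ((((S \ I) \ B).filter (fun v => (∃ z ∈ J, G.Adj v z) ∧
        ∃ z ∈ C, G.Adj v z)) ∪ (B \ NC)) := by
      intro v hv
      simp only [Finset.mem_union]
      by_cases hvC : v ∈ NC
      · exact Or.inl (Or.inl hvC)
      by_cases hvJ : v ∈ NJ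
      · exact Or.inl (Or.inr hvJ)
      right
      by_cases hvB : v ∈ B
      · right; exact Finset.mem_sdiff.2 ⟨hvB, hvC⟩
      left
      have hvI : v ∉ I := by
        intro hvI
        by_cases h : v ∈ J
        · apply hvC
          refine Finset.mem_filter.2 ⟨Finset.mem_sdiff.2 ⟨hv, fun h' => (Finset.mem_sdiff.1 h').2 h⟩, ?_⟩
          intro z hz hvz
          exact hI hvI (hCI hz) hvz.ne hvz
        · apply hvJ
          refine Finset.mem_filter.2 ⟨Finset.mem_sdiff.2 ⟨hv, h⟩, ?_⟩
          intro z hz hvz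
          exact hI hvI (hJ hz) hvz.ne hvz
      refine Finset.mem_filter.2 ⟨Finset.mem_sdiff.2 ⟨Finset.mem_sdiff.2 ⟨hv, hvI⟩, hvB⟩, ?_, ?_⟩
      · by_contra h
        push Not at h
        exact hvJ (Finset.mem_filter.2 ⟨Finset.mem_sdiff.2 ⟨hv, fun h' => hvI (hJ h')⟩, h⟩)
      · by_contra h
        push Not at h
        exact hvC (Finset.mem_filter.2 ⟨Finset.mem_sdiff.2 ⟨hv, fun h' => hvI (hCI h')⟩, h⟩)
    have htok : B.filter (fun v => ∀ z ∈ I, G.Adj v z → z ∈ J) ⊆ B ∩ NC := by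
      intro v hv
      obtain ⟨hvB, h⟩ := Finset.mem_filter.1 hv
      have hvS := Finset.mem_sdiff.1 (hB hvB)
      refine Finset.mem_inter.2 ⟨hvB, Finset.mem_filter.2
        ⟨Finset.mem_sdiff.2 ⟨hvS.1, fun h' => hvS.2 (hCI h')⟩, ?_⟩⟩
      intro z hz hvz
      exact (Finset.mem_sdiff.1 hz).2 (h z (hCI hz) hvz)
    have c1 := Finset.card_le_card cover
    have c2 := Finset.card_le_card htok
    have c3 := Finset.card_union_le (NC ∪ NJ) ((((S \ I) \ B).filter (fun v => (∃ z ∈ J, G.Adj v z) ∧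
        ∃ z ∈ C, G.Adj v z)) ∪ (B \ NC))
    have c4 := Finset.card_union_le NC NJ
    have c5 := Finset.card_union_le (((S \ I) \ B).filter (fun v => (∃ z ∈ J, G.Adj v z) ∧
        ∃ z ∈ C, G.Adj v z)) (B \ NC)
    have c6 := Finset.card_sdiff_add_card_inter B NC
    have key : NC.card + NJ.card + k ≤ S.card := by
      have hst := hstep i hi
      have hk0 : (0 : ℚ) ≤ k := by positivity
      have hq : ((NC.card + NJ.card + k : ℕ) : ℚ) ≤ S.card := by
        push_cast
        by_cases hJs : J.card = 1
        · have e1 := hclq NC hNCS (hJs ▸ haC)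
          have e2 := hsmall C.card hC1 (by omega) NJ hNJS haJ
          rw [show C.card = i - 1 by omega] at e2
          have e1' : (NC.card : ℚ) ≤ k := by exact_mod_cast e1
          nlinarith
        by_cases hCs : C.card = 1
        · have e1 := hclq NJ hNJS (hCs ▸ haJ)
          have e2 := hsmall J.card hJ1 (by omega) NC hNCS haC
          rw [show J.card = i - 1 by omega] at e2
          have e1' : (NJ.card : ℚ) ≤ k := by exact_mod_cast e1
          nlinarith
        · have e1 := hsmall J.card hJ1 (by omega) NC hNCS haC
          have e2 := hsmall C.card hC1 (by omega) NJ hNJS haJ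
          have e3 := hsplit i hi C.card J.card (by omega) (by omega) (by omega) (by omega) hCJ
          have e4 : (1 : ℚ) ≤ (2 * (i : ℚ) - 1) / (i : ℚ) := by
            have : (3 : ℚ) ≤ i := by exact_mod_cast hi
            rw [le_div_iff₀ (by linarith)]
            linarith
          nlinarith
      exact_mod_cast hq
    omega

lemma main_general [Finite V] (β : ℕ → ℚ) (hβ1 : β 1 = 1) (hβ2 : β 2 = 5 / 2)
    (hstep : ∀ i : ℕ, 3 ≤ i → β (i - 1) + 2 ≤ β i)
    (hsplit : ∀ i : ℕ, 3 ≤ i → ∀ s t : ℕ, 2 ≤ s → s ≤ i - 2 → 2 ≤ t → t ≤ i - 2 →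
      s + t = i → β s + β t + (2 * (i : ℚ) - 1) / (i : ℚ) ≤ β i)
    (h2 : ∀ (S : Finset V) (k : ℕ), AlphaLe G S 2 → 5 * k ≤ S.card → HasImm G S (2 * k)) :
    ∀ i : ℕ, 1 ≤ i → (i : ℚ) ≤ β i ∧ ∀ (k : ℕ) (S : Finset V), AlphaLe G S i →
      β i * (k + 1) ≤ S.card → HasImm G S k := by
  intro i
  induction i using Nat.strong_induction_on with
  | _ i ih =>
  intro hi
  rcases (by omega : i = 1 ∨ i = 2 ∨ 3 ≤ i) with rfl | rfl | hi3
  · refine ⟨by simp [hβ1], ?_⟩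
    intro k S hα hk
    rw [hβ1] at hk
    have : k + 1 ≤ S.card := by
      have : ((k + 1 : ℕ) : ℚ) ≤ S.card := by push_cast; linarith
      exact_mod_cast this
    exact (clique_imm (clique_of_alpha_one hα)).mono le_rfl subset_rfl (by omega)
  · refine ⟨by rw [hβ2]; norm_num, ?_⟩
    intro k S hα hk
    rw [hβ2] at hk
    have : 5 * (k + 1) ≤ 2 * S.card := by
      have : ((5 * (k + 1) : ℕ) : ℚ) ≤ (2 * S.card : ℕ) := by push_cast; linarith
      exact_mod_cast this
    exact (h2 S (S.card / 5) hα (by omega)).mono le_rfl subset_rfl (by omega)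
  · have hst := hstep i hi3
    have hprev := ih (i - 1) (by omega) (by omega)
    have hβi : (i : ℚ) ≤ β i := by
      have := hprev.1
      rw [Nat.cast_sub (by omega)] at this
      push_cast at this
      linarith
    refine ⟨hβi, ?_⟩
    intro k
    induction k with
    | zero => intro S _ _; exact HasImm.zero S
    | succ k ihk =>
      intro S hα hcard
      push_cast at hcard
      by_contra hno
      by_cases hα' : AlphaLe G S (i - 1)
      · apply hno
        apply hprev.2 (k + 1) S hα'
        push_cast
        have hk0 : (0 : ℚ) ≤ k := by positivity
        nlinarith
      · unfold AlphaLe at hα'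
        push Not at hα'
        obtain ⟨I, hIS, hI, hIc⟩ := hα'
        have hIc' : I.card = i := by have := hα I hIS hI; omega
        obtain ⟨B, hB, hBk, him⟩ := ihk (S \ I) (hα.mono Finset.sdiff_subset le_rfl) (by
          rw [Finset.cast_card_sdiff hIS, hIc']
          nlinarith)
        apply hno
        refine step_general β hstep hsplit i k hi3 S I B hα (by linarith) hIS hI hIc' hB hBk him ?_ ?_
        · intro s hs hsi T hT hTα
          by_contra hlt
          push Not at hlt
          apply hno
          exact ((ih s hsi hs).2 (k + 1) T hTα (by push_cast; linarith)).mono le_rfl hT le_rfl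
        · intro T hT hTα
          by_contra hlt
          push Not at hlt
          apply hno
          exact (clique_imm (clique_of_alpha_one hTα)).mono le_rfl hT (by omega)

lemma no_triple {S : Finset V} (h : AlphaLe G S 2) {a b c : V} (ha : a ∈ S) (hb : b ∈ S)
    (hc : c ∈ S) (hab : a ≠ b) (hac : a ≠ c) (hbc : b ≠ c) (nab : ¬ G.Adj a b)
    (nac : ¬ G.Adj a c) (nbc : ¬ G.Adj b c) : False := by
  have := h {a, b, c} (by intro x; simp; rintro (rfl | rfl | rfl) <;> assumption) (by
    intro x hx y hy hxy
    simp at hx hy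
    rcases hx with rfl | rfl | rfl <;> rcases hy with rfl | rfl | rfl <;> simp_all [G.adj_comm])
  rw [Finset.card_eq_three.2 ⟨a, b, c, hab, hac, hbc, rfl⟩] at this
  omega

/-- induced five-cycle inside `S` -/
structure C5 (G : SimpleGraph V) (S : Finset V) (x0 x1 x2 x3 x4 : V) : Prop where
  m0 : x0 ∈ S
  m1 : x1 ∈ S
  m2 : x2 ∈ S
  m3 : x3 ∈ S
  m4 : x4 ∈ S
  a01 : G.Adj x0 x1
  a12 : G.Adj x1 x2
  a23 : G.Adj x2 x3
  a34 : G.Adj x3 x4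
  a40 : G.Adj x4 x0
  n02 : ¬ G.Adj x0 x2
  n13 : ¬ G.Adj x1 x3
  n24 : ¬ G.Adj x2 x4
  n30 : ¬ G.Adj x3 x0
  n41 : ¬ G.Adj x4 x1

lemma C5.rot {S : Finset V} {x0 x1 x2 x3 x4 : V} (h : C5 G S x0 x1 x2 x3 x4) :
    C5 G S x1 x2 x3 x4 x0 :=
  ⟨h.m1, h.m2, h.m3, h.m4, h.m0, h.a12, h.a23, h.a34, h.a40, h.a01, h.n13, h.n24, h.n30, h.n41, h.n02⟩

lemma C5.ne02 {S : Finset V} {x0 x1 x2 x3 x4 : V} (h : C5 G S x0 x1 x2 x3 x4) : x0 ≠ x2 := by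
  rintro rfl
  exact h.n24 h.a40.symm

lemma C5.adj_or {S : Finset V} {x0 x1 x2 x3 x4 : V} (h : C5 G S x0 x1 x2 x3 x4)
    (hα : AlphaLe G S 2) {v : V} (hv : v ∈ S) (h0 : v ≠ x0) (h2 : v ≠ x2) (hn : ¬ G.Adj v x0) :
    G.Adj v x2 := by
  by_contra hn2
  exact no_triple hα hv h.m0 h.m2 h0 h2 h.ne02 hn hn2 h.n02

lemma find_C5 {S : Finset V} (hα : AlphaLe G S 2)
    (hcrit : ∀ a ∈ S, ∀ b ∈ S, G.Adj a b → ∃ w ∈ S, w ≠ a ∧ w ≠ b ∧ ¬ G.Adj w a ∧ ¬ G.Adj w b) :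
    (∃ T ⊆ S, (∀ u ∈ T, ∀ v ∈ T, u ≠ v → G.Adj u v) ∧ S.card ≤ 2 * T.card) ∨
    ∃ x0 x1 x2 x3 x4, C5 G S x0 x1 x2 x3 x4 := by
  rcases S.eq_empty_or_nonempty with rfl | ⟨v, hv⟩
  · left; exact ⟨∅, by simp, by simp, by simp⟩
  let N := S.filter (fun w => w ≠ v ∧ ¬ G.Adj w v)
  let R := S.filter (fun w => w = v ∨ G.Adj w v)
  have hN : ∀ a ∈ N, ∀ b ∈ N, a ≠ b → G.Adj a b := by
    intro a ha b hb hab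
    obtain ⟨ha, ha1, ha2⟩ := Finset.mem_filter.1 ha
    obtain ⟨hb, hb1, hb2⟩ := Finset.mem_filter.1 hb
    by_contra h
    exact no_triple hα ha hb hv hab ha1 hb1 h ha2 hb2
  by_cases hR : ∀ a ∈ R, ∀ b ∈ R, a ≠ b → G.Adj a b
  · left
    have hsum : S.card ≤ N.card + R.card := by
      refine le_trans (Finset.card_le_card ?_) (Finset.card_union_le N R)
      intro w hw
      by_cases h : w = v ∨ G.Adj w v
      · exact Finset.mem_union_right _ (Finset.mem_filter.2 ⟨hw, h⟩)
      · push Not at h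
        exact Finset.mem_union_left _ (Finset.mem_filter.2 ⟨hw, h⟩)
    rcases le_total N.card R.card with h | h
    · exact ⟨R, Finset.filter_subset _ _, hR, by omega⟩
    · exact ⟨N, Finset.filter_subset _ _, hN, by omega⟩
  · right
    push Not at hR
    obtain ⟨p, hp, q, hq, hpq, hnpq⟩ := hR
    obtain ⟨hpS, hp'⟩ := Finset.mem_filter.1 hp
    obtain ⟨hqS, hq'⟩ := Finset.mem_filter.1 hq
    have hpv : G.Adj p v := by
      rcases hp' with rfl | h
      · rcases hq' with rfl | h'
        · exact absurd rfl hpq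
        · exact absurd h'.symm hnpq
      · exact h
    have hqv : G.Adj q v := by
      rcases hq' with rfl | h
      · exact absurd hpv hnpq
      · exact h
    obtain ⟨p', hp'S, hpp, hpv', hnp, hnpv⟩ := hcrit p hpS v hv hpv
    obtain ⟨q', hq'S, hqq, hqv', hnq, hnqv⟩ := hcrit q hqS v hv hqv
    have hp'q : p' ≠ q := by rintro rfl; exact hnpv hqv
    have hq'p : q' ≠ p := by rintro rfl; exact hnqv hpv
    have h1 : G.Adj p' q := by
      by_contra h
      exact no_triple hα hp'S hpS hqS hpp hp'q hpq hnp h hnpq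
    have h2 : G.Adj q' p := by
      by_contra h
      exact no_triple hα hq'S hqS hpS hqq hq'p hpq.symm hnq h (fun h => hnpq h.symm)
    have hne : p' ≠ q' := by rintro rfl; exact hnq h1
    have h3 : G.Adj p' q' := by
      by_contra h
      exact no_triple hα hp'S hq'S hv hne hpv' hqv' h hnpv hnqv
    exact ⟨v, p, q', p', q, hv, hpS, hq'S, hp'S, hqS, hpv.symm, h2.symm, h3.symm, h1, hqv,
      fun h => hnqv h.symm, fun h => hnp h.symm, hnq, hnpv, fun h => hnpq h.symm⟩

lemma crit_sub [Finite V] (G : SimpleGraph V) {S : Finset V} (hα : AlphaLe G S 2) :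
    ∃ G' ≤ G, AlphaLe G' S 2 ∧ ∀ a ∈ S, ∀ b ∈ S, G'.Adj a b →
      ∃ w ∈ S, w ≠ a ∧ w ≠ b ∧ ¬ G'.Adj w a ∧ ¬ G'.Adj w b := by
  obtain ⟨G', hle, hmin⟩ := (Set.toFinite {G' : SimpleGraph V | AlphaLe G' S 2}).exists_le_minimal hα
  refine ⟨G', hle, hmin.1, ?_⟩
  intro a ha b hb hab
  have hnot : ¬ AlphaLe (G'.deleteEdges {s(a, b)}) S 2 := by
    intro h
    have := hmin.2 h (G'.deleteEdges_le _) hab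
    simp at this
  unfold AlphaLe at hnot
  push Not at hnot
  obtain ⟨I, hIS, hI, hIc⟩ := hnot
  have hI' : ∀ u ∈ I, ∀ v ∈ I, u ≠ v → G'.Adj u v → s(u, v) = s(a, b) := by
    intro u hu v hv huv h
    have := hI hu hv huv
    simp only [SimpleGraph.deleteEdges_adj, Set.mem_singleton_iff] at this
    tauto
  have habI : a ∈ I ∧ b ∈ I := by
    by_contra hcon
    have := hmin.1 I hIS (by
      intro u hu v hv huv h
      have := hI' u hu v hv huv h
      rw [Sym2.eq_iff] at this
      rcases this with ⟨rfl, rfl⟩ | ⟨rfl, rfl⟩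
      · exact hcon ⟨hu, hv⟩
      · exact hcon ⟨hv, hu⟩)
    omega
  obtain ⟨w, hwI, hw⟩ : ∃ w ∈ I, w ∉ ({a, b} : Finset V) := by
    apply Finset.exists_mem_notMem_of_card_lt_card
    exact lt_of_le_of_lt Finset.card_le_two hIc
  simp only [Finset.mem_insert, Finset.mem_singleton, not_or] at hw
  refine ⟨w, hIS hwI, hw.1, hw.2, ?_, ?_⟩
  · intro h
    have := hI' w hwI a habI.1 hw.1 h
    rw [Sym2.eq_iff] at this
    tauto
  · intro h
    have := hI' w hwI b habI.2 hw.2 h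
    rw [Sym2.eq_iff] at this
    tauto

lemma deficit_card {S B W A : Finset V} {k : ℕ} (x : V) (hα : AlphaLe G S 2)
    (hxS : x ∈ S) (hxW : x ∉ W) (hxB : x ∉ B) (hBS : B ⊆ S) (hWS : W ⊆ S)
    (hBW : Disjoint B W) (hA : A ⊆ W)
    (hclq : ∀ T ⊆ S, (∀ u ∈ T, ∀ v ∈ T, u ≠ v → G.Adj u v) → T.card ≤ 2 * k + 1)
    (hk : 2 * k + 1 + A.card ≤ W.card) :
    (B.filter (fun v => ¬ G.Adj v x)).card ≤ ((W \ A).filter (fun w => G.Adj w x)).card := by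
  have h1 : (B.filter (fun v => ¬ G.Adj v x) ∪ W.filter (fun v => ¬ G.Adj v x)).card ≤ 2 * k + 1 := by
    have hmem : ∀ v ∈ B.filter (fun v => ¬ G.Adj v x) ∪ W.filter (fun v => ¬ G.Adj v x),
        v ∈ S ∧ v ≠ x ∧ ¬ G.Adj v x := by
      intro v hv
      simp only [Finset.mem_union, Finset.mem_filter] at hv
      rcases hv with ⟨h, h'⟩ | ⟨h, h'⟩
      · exact ⟨hBS h, fun e => hxB (e ▸ h), h'⟩
      · exact ⟨hWS h, fun e => hxW (e ▸ h), h'⟩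
    apply hclq
    · exact fun v hv => (hmem v hv).1
    · intro u hu v hv huv
      by_contra h
      obtain ⟨a1, a2, a3⟩ := hmem u hu
      obtain ⟨b1, b2, b3⟩ := hmem v hv
      exact no_triple hα a1 b1 hxS huv a2 b2 h a3 b3
  rw [Finset.card_union_of_disjoint (Finset.disjoint_filter_filter hBW)] at h1
  have h2 : (W \ A).card ≤ ((W \ A).filter (fun w => G.Adj w x)).card +
      (W.filter (fun v => ¬ G.Adj v x)).card := by
    refine le_trans (Finset.card_le_card ?_) (Finset.card_union_le _ _)
    intro w hw
    by_cases h : G.Adj w x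
    · exact Finset.mem_union_left _ (Finset.mem_filter.2 ⟨hw, h⟩)
    · exact Finset.mem_union_right _ (Finset.mem_filter.2 ⟨(Finset.mem_sdiff.1 hw).1, h⟩)
  have h3 := Finset.card_sdiff_add_card_eq_card hA
  omega

lemma extend_two {S X B : Finset V} {k : ℕ} {x0 x1 x2 x3 x4 : V} (h5 : C5 G S x0 x1 x2 x3 x4)
    (hα : AlphaLe G S 2) (hX : ∀ v, v ∈ X ↔ v = x0 ∨ v = x1 ∨ v = x2 ∨ v = x3 ∨ v = x4)
    (hB : B ⊆ S \ X) (hBk : B.card = 2 * k) (him : Imm G (S \ X) B)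
    (hW : 3 * k ≤ ((S \ X) \ B).card)
    (hclq : ∀ T ⊆ S, (∀ u ∈ T, ∀ v ∈ T, u ≠ v → G.Adj u v) → T.card ≤ 2 * k + 1)
    (hA : 5 * (((S \ X) \ B).filter (fun w => ¬ G.Adj w x3 ∧ ¬ G.Adj w x4)).card ≤
      ((S \ X) \ B).card) : Imm G S (insert x0 (insert x2 B)) := by
  set W := (S \ X) \ B with hWdef
  set A := W.filter (fun w => ¬ G.Adj w x3 ∧ ¬ G.Adj w x4) with hAdef
  have hAW : A ⊆ W := Finset.filter_subset _ _
  have hXS : X ⊆ S := by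
    intro v hv
    rcases (hX v).1 hv with rfl | rfl | rfl | rfl | rfl
    exacts [h5.m0, h5.m1, h5.m2, h5.m3, h5.m4]
  have X0 : x0 ∈ X := by simp [hX]
  have X1 : x1 ∈ X := by simp [hX]
  have X2 : x2 ∈ X := by simp [hX]
  have X3 : x3 ∈ X := by simp [hX]
  have X4 : x4 ∈ X := by simp [hX]
  have hWX : ∀ w ∈ W, w ∈ S ∧ w ∉ X ∧ w ∉ B := by
    intro w hw
    simpa [hWdef, and_assoc] using hw
  have hBX : ∀ w ∈ B, w ∈ S ∧ w ∉ X := fun w hw => Finset.mem_sdiff.1 (hB hw)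
  have hBW : Disjoint B W := Finset.disjoint_right.2 fun w hw => (hWX w hw).2.2
  have hneX : ∀ {v z}, v ∉ X → z ∈ X → v ≠ z := fun hv hz h => hv (h ▸ hz)
  -- adjacency alternatives
  have or02 : ∀ {v}, v ∈ S → v ∉ X → ¬ G.Adj v x0 → G.Adj v x2 := fun hv hvX hn =>
    h5.adj_or hα hv (hneX hvX X0) (hneX hvX X2) hn
  have or13 : ∀ {v}, v ∈ S → v ∉ X → ¬ G.Adj v x1 → G.Adj v x3 := fun hv hvX hn =>
    h5.rot.adj_or hα hv (hneX hvX X1) (hneX hvX X3) hn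
  have or24 : ∀ {v}, v ∈ S → v ∉ X → ¬ G.Adj v x2 → G.Adj v x4 := fun hv hvX hn =>
    h5.rot.rot.adj_or hα hv (hneX hvX X2) (hneX hvX X4) hn
  have or30 : ∀ {v}, v ∈ S → v ∉ X → ¬ G.Adj v x3 → G.Adj v x0 := fun hv hvX hn =>
    h5.rot.rot.rot.adj_or hα hv (hneX hvX X3) (hneX hvX X0) hn
  have or41 : ∀ {v}, v ∈ S → v ∉ X → ¬ G.Adj v x4 → G.Adj v x1 := fun hv hvX hn =>
    h5.rot.rot.rot.rot.adj_or hα hv (hneX hvX X4) (hneX hvX X1) hn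
  let τ : V → V := fun b => if G.Adj b x0 then x2 else x0
  let D := B.filter (fun b => ¬ G.Adj b (τ b))
  let t : V → Finset V := fun b => (W \ A).filter (fun w => G.Adj w (τ b))
  have hτ0 : ∀ b, ¬ G.Adj b x0 → τ b = x0 := fun b h => by simp [τ, h]
  have hτ2 : ∀ b, G.Adj b x0 → τ b = x2 := fun b h => by simp [τ, h]
  obtain ⟨f, hf, hft⟩ := hall_on D t (by
    intro s hs
    rcases s.eq_empty_or_nonempty with rfl | ⟨b, hb⟩
    · simp
    have hsB : s ⊆ B := hs.trans (Finset.filter_subset _ _)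
    have hk1 : 1 ≤ k := by
      have := Finset.card_pos.2 ⟨b, hsB hb⟩
      omega
    have hWA := Finset.card_sdiff_add_card_eq_card hAW
    have hBS : B ⊆ S := fun v hv => (hBX v hv).1
    have hWS : W ⊆ S := fun v hv => (hWX v hv).1
    have big : 2 * k + 1 + A.card ≤ W.card := by omega
    by_cases hall0 : ∃ b ∈ s, ¬ G.Adj b x0
    · obtain ⟨b0, hb0, hb0'⟩ := hall0
      by_cases hall2 : ∃ b ∈ s, G.Adj b x0
      · obtain ⟨b2, hb2, hb2'⟩ := hall2
        have hsub : W \ A ⊆ s.biUnion t := by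
          intro w hw
          have hw' := hWX w (Finset.mem_sdiff.1 hw).1
          by_cases h : G.Adj w x0
          · exact Finset.mem_biUnion.2 ⟨b0, hb0, Finset.mem_filter.2 ⟨hw, by rw [hτ0 _ hb0']; exact h⟩⟩
          · exact Finset.mem_biUnion.2 ⟨b2, hb2, Finset.mem_filter.2
              ⟨hw, by rw [hτ2 _ hb2']; exact or02 hw'.1 hw'.2.1 h⟩⟩
        have e1 := Finset.card_le_card hsub
        have e2 := Finset.card_le_card hsB
        omega
      · push Not at hall2
        have e1 := deficit_card (A := A) x0 hα h5.m0 (fun h => (hWX _ h).2.1 X0)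
          (fun h => (hBX _ h).2 X0) hBS hWS hBW hAW hclq big
        refine le_trans (Finset.card_le_card ?_) (e1.trans (Finset.card_le_card ?_))
        · intro v hv
          exact Finset.mem_filter.2 ⟨hsB hv, hall2 v hv⟩
        · intro w hw
          exact Finset.mem_biUnion.2 ⟨b0, hb0, by simpa only [t, hτ0 _ hb0'] using hw⟩
    · push Not at hall0
      have e1 := deficit_card (A := A) x2 hα h5.m2 (fun h => (hWX _ h).2.1 X2)
        (fun h => (hBX _ h).2 X2) hBS hWS hBW hAW hclq big
      refine le_trans (Finset.card_le_card ?_) (e1.trans (Finset.card_le_card ?_))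
      · intro v hv
        have := (Finset.mem_filter.1 (hs hv)).2
        rw [hτ2 _ (hall0 v hv)] at this
        exact Finset.mem_filter.2 ⟨hsB hv, this⟩
      · intro w hw
        exact Finset.mem_biUnion.2 ⟨b, hb, by simpa only [t, hτ2 _ (hall0 b hb)] using hw⟩)
  have hfm : ∀ b ∈ D, f b ∈ W ∧ (G.Adj (f b) x3 ∨ G.Adj (f b) x4) ∧ G.Adj (f b) (τ b) := by
    intro b hb
    obtain ⟨h1, h2⟩ := Finset.mem_filter.1 (hft b hb)
    obtain ⟨h3, h4⟩ := Finset.mem_sdiff.1 h1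
    refine ⟨h3, ?_, h2⟩
    by_contra hc
    push Not at hc
    exact h4 (Finset.mem_filter.2 ⟨h3, hc⟩)
  let own : V → Sym2 V := fun w => if h : ∃ b ∈ D, f b = w then s(h.choose, τ h.choose) else s(w, w)
  have hown : ∀ b ∈ D, own (f b) = s(b, τ b) := by
    intro b hb
    have h : ∃ b' ∈ D, f b' = f b := ⟨b, hb, rfl⟩
    have : h.choose = b := hf h.choose_spec.1 hb h.choose_spec.2
    simp only [own, h, dif_pos]
    rw [this]
  let g : V → V → Sym2 V := fun w z => if w ∈ B then
    (if z = x0 then s(w, x0) else if z = x2 then s(w, x2) else s(w, τ w)) else own w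
  obtain ⟨c, hc⟩ := him
  obtain ⟨c', hc1, hc2, hc3⟩ := recolor c X g s(x0, x2)
  have edge : ∀ w z d, w ∈ S → w ∉ X → z ∈ X → G.Adj w z → g w z = d → (Gr G c' S d).Adj w z := by
    intro w z d hw hwX hz hwz hd
    exact ⟨hwz, hw, hXS hz, by rw [hc1 w z hwX hz, hd]⟩
  have indirect : ∀ b ∈ B, ¬ G.Adj b (τ b) →
      (∀ w ∈ W, (G.Adj w x3 ∨ G.Adj w x4) → G.Adj w (τ b) →
        ∃ z ∈ X, z ≠ x0 ∧ z ≠ x2 ∧ G.Adj b z ∧ G.Adj w z) →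
      (Gr G c' S s(b, τ b)).Reachable b (τ b) := by
    intro b hb hn hz
    have hbD : b ∈ D := Finset.mem_filter.2 ⟨hb, hn⟩
    obtain ⟨f1, f2, f3⟩ := hfm b hbD
    obtain ⟨z, hzX, hz0, hz2, hbz, hwz⟩ := hz _ f1 f2 f3
    have hτX : τ b ∈ X := by
      by_cases h : G.Adj b x0
      · rw [hτ2 b h]; exact X2
      · rw [hτ0 b h]; exact X0
    obtain ⟨w1, w2, w3⟩ := hWX _ f1
    obtain ⟨b1, b2⟩ := hBX _ hb
    have e1 := edge b z s(b, τ b) b1 b2 hzX hbz (by simp [g, hb, hz0, hz2])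
    have e2 := edge (f b) z s(b, τ b) w1 w2 hzX hwz (by simp only [g, w3, if_false]; exact hown b hbD)
    have e3 := edge (f b) (τ b) s(b, τ b) w1 w2 hτX f3
      (by simp only [g, w3, if_false]; exact hown b hbD)
    exact e1.reachable.trans (e2.symm.reachable.trans e3.reachable)
  have ne10 : x1 ≠ x0 := h5.a01.ne.symm
  have ne12 : x1 ≠ x2 := h5.a12.ne
  have ne30 : x3 ≠ x0 := h5.rot.rot.rot.ne02
  have ne32 : x3 ≠ x2 := h5.a23.ne.symm
  have ne40 : x4 ≠ x0 := h5.a40.ne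
  have ne42 : x4 ≠ x2 := h5.rot.rot.ne02.symm
  have to0 : ∀ b ∈ B, (Gr G c' S s(b, x0)).Reachable b x0 := by
    intro b hb
    obtain ⟨b1, b2⟩ := hBX _ hb
    by_cases h : G.Adj b x0
    · exact (edge b x0 _ b1 b2 X0 h (by simp [g, hb])).reachable
    · have h' := hτ0 b h
      have := indirect b hb (by rw [h']; exact h) (by
        intro w hw hw34 hw0
        obtain ⟨w1, w2, w3⟩ := hWX _ hw
        have hb3 : G.Adj b x3 := by
          by_contra hcon
          exact h (or30 b1 b2 hcon)
        by_cases hw3 : G.Adj w x3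
        · exact ⟨x3, X3, ne30, ne32, hb3, hw3⟩
        · have hw4 : G.Adj w x4 := by tauto
          have hw1 : G.Adj w x1 := by
            by_contra hcon
            exact hw3 (or13 w1 w2 hcon)
          by_cases hb4 : G.Adj b x4
          · exact ⟨x4, X4, ne40, ne42, hb4, hw4⟩
          · exact ⟨x1, X1, ne10, ne12, or41 b1 b2 hb4, hw1⟩)
      rwa [h'] at this
  have to2 : ∀ b ∈ B, (Gr G c' S s(b, x2)).Reachable b x2 := by
    intro b hb
    obtain ⟨b1, b2⟩ := hBX _ hb
    by_cases h : G.Adj b x2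
    · exact (edge b x2 _ b1 b2 X2 h (by simp [g, hb, h5.ne02.symm])).reachable
    · have hb0 : G.Adj b x0 := by
        by_contra hcon
        exact h (or02 b1 b2 hcon)
      have h' := hτ2 b hb0
      have := indirect b hb (by rw [h']; exact h) (by
        intro w hw hw34 hw0
        obtain ⟨w1, w2, w3⟩ := hWX _ hw
        have hb4 : G.Adj b x4 := or24 b1 b2 h
        by_cases hw4 : G.Adj w x4
        · exact ⟨x4, X4, ne40, ne42, hb4, hw4⟩
        · have hw3 : G.Adj w x3 := by tauto
          have hw1 : G.Adj w x1 := or41 w1 w2 hw4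
          by_cases hb1 : G.Adj b x1
          · exact ⟨x1, X1, ne10, ne12, hb1, hw1⟩
          · exact ⟨x3, X3, ne30, ne32, or13 b1 b2 hb1, hw3⟩)
      rwa [h'] at this
  have x02 : (Gr G c' S s(x0, x2)).Reachable x0 x2 := by
    have e1 : (Gr G c' S s(x0, x2)).Adj x0 x1 := ⟨h5.a01, h5.m0, h5.m1, hc3 _ _ X0 X1⟩
    have e2 : (Gr G c' S s(x0, x2)).Adj x1 x2 := ⟨h5.a12, h5.m1, h5.m2, hc3 _ _ X1 X2⟩
    exact e1.reachable.trans e2.reachable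
  refine ⟨c', ?_⟩
  intro u hu v hv huv
  simp only [Finset.mem_insert] at hu hv
  rcases hu with hu | hu | hu <;> rcases hv with hv | hv | hv
  · exact absurd (hu.trans hv.symm) huv
  · rw [hu, hv]; exact x02
  · rw [hu, Sym2.eq_swap]; exact (to0 v hv).symm
  · rw [hu, hv, Sym2.eq_swap]; exact x02.symm
  · exact absurd (hu.trans hv.symm) huv
  · rw [hu, Sym2.eq_swap]; exact (to2 v hv).symm
  · rw [hv]; exact to0 u hu
  · rw [hv]; exact to2 u hu
  · refine (hc u hu v hv huv).mono ?_
    intro a b hab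
    have ha := Finset.mem_sdiff.1 hab.2.1
    have hb := Finset.mem_sdiff.1 hab.2.2.1
    exact ⟨hab.1, ha.1, hb.1, by rw [hc2 a b ha.2 hb.2]; exact hab.2.2.2⟩

lemma extend_two' {S X B : Finset V} {k : ℕ} {x0 x1 x2 x3 x4 : V} (h5 : C5 G S x0 x1 x2 x3 x4)
    (hα : AlphaLe G S 2) (hX : ∀ v, v ∈ X ↔ v = x0 ∨ v = x1 ∨ v = x2 ∨ v = x3 ∨ v = x4)
    (hB : B ⊆ S \ X) (hBk : B.card = 2 * k) (him : Imm G (S \ X) B)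
    (hW : 3 * k ≤ ((S \ X) \ B).card)
    (hclq : ∀ T ⊆ S, (∀ u ∈ T, ∀ v ∈ T, u ≠ v → G.Adj u v) → T.card ≤ 2 * k + 1)
    (hA : 5 * (((S \ X) \ B).filter (fun w => ¬ G.Adj w x3 ∧ ¬ G.Adj w x4)).card ≤
      ((S \ X) \ B).card) : HasImm G S (2 * (k + 1)) := by
  have hBX : ∀ w ∈ B, w ∈ S ∧ w ∉ X := fun w hw => Finset.mem_sdiff.1 (hB hw)
  have h2 : x2 ∉ B := fun h => (hBX _ h).2 (by simp [hX])
  have h0 : x0 ∉ insert x2 B := by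
    intro h
    rcases Finset.mem_insert.1 h with h | h
    · exact h5.ne02 h
    · exact (hBX _ h).2 (by simp [hX])
  refine ⟨_, ?_, ?_, extend_two h5 hα hX hB hBk him hW hclq hA⟩
  · intro v hv
    simp only [Finset.mem_insert] at hv
    rcases hv with rfl | rfl | h
    exacts [h5.m0, h5.m2, (hBX v h).1]
  · rw [Finset.card_insert_of_notMem h0, Finset.card_insert_of_notMem h2, hBk]
    ring

lemma five_sum {S W : Finset V} {x0 x1 x2 x3 x4 : V} (h5 : C5 G S x0 x1 x2 x3 x4)
    (hα : AlphaLe G S 2) (hWS : ∀ w ∈ W, w ∈ S ∧ w ≠ x0 ∧ w ≠ x1 ∧ w ≠ x2 ∧ w ≠ x3 ∧ w ≠ x4) :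
    (W.filter (fun w => ¬ G.Adj w x0 ∧ ¬ G.Adj w x1)).card +
    (W.filter (fun w => ¬ G.Adj w x1 ∧ ¬ G.Adj w x2)).card +
    (W.filter (fun w => ¬ G.Adj w x2 ∧ ¬ G.Adj w x3)).card +
    (W.filter (fun w => ¬ G.Adj w x3 ∧ ¬ G.Adj w x4)).card +
    (W.filter (fun w => ¬ G.Adj w x4 ∧ ¬ G.Adj w x0)).card ≤ W.card := by
  simp only [Finset.card_filter, ← Finset.sum_add_distrib]
  rw [Finset.card_eq_sum_ones]
  apply Finset.sum_le_sum
  intro w hw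
  obtain ⟨hS, n0, n1, n2, n3, n4⟩ := hWS w hw
  have a := h5.adj_or hα hS n0 n2
  have b := h5.rot.adj_or hα hS n1 n3
  have c := h5.rot.rot.adj_or hα hS n2 n4
  have d := h5.rot.rot.rot.adj_or hα hS n3 n0
  have e := h5.rot.rot.rot.rot.adj_or hα hS n4 n1
  by_cases q0 : G.Adj w x0 <;> by_cases q1 : G.Adj w x1 <;> by_cases q2 : G.Adj w x2 <;>
    by_cases q3 : G.Adj w x3 <;> by_cases q4 : G.Adj w x4 <;> simp_all

lemma or_rot (a b c d e : Prop) : (a ∨ b ∨ c ∨ d ∨ e) ↔ (b ∨ c ∨ d ∨ e ∨ a) := by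
  rw [or_comm]; simp only [or_assoc]

lemma alpha_two [Finite V] (k : ℕ) : ∀ (G : SimpleGraph V) (S : Finset V), AlphaLe G S 2 →
    5 * k ≤ S.card → HasImm G S (2 * k) := by
  induction k with
  | zero => intro G S _ _; exact HasImm.zero S
  | succ k ih =>
    intro G0 S hα0 hS
    obtain ⟨G, hle, hα, hcrit⟩ := crit_sub G0 hα0
    refine HasImm.mono (G := G) ?_ hle subset_rfl le_rfl
    by_contra hno
    have hclq : ∀ T ⊆ S, (∀ u ∈ T, ∀ v ∈ T, u ≠ v → G.Adj u v) → T.card ≤ 2 * k + 1 := by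
      intro T hT hTc
      by_contra hlt
      exact hno ((clique_imm hTc).mono le_rfl hT (by omega))
    rcases find_C5 hα hcrit with ⟨T, hT, hTc, hcard⟩ | ⟨x0, x1, x2, x3, x4, h5⟩
    · have := hclq T hT hTc
      omega
    · let X : Finset V := {x0, x1, x2, x3, x4}
      have hX : ∀ v, v ∈ X ↔ v = x0 ∨ v = x1 ∨ v = x2 ∨ v = x3 ∨ v = x4 := by simp [X]
      have hX5 : X.card ≤ 5 := Finset.card_le_five
      have hSX := Finset.le_card_sdiff X S
      obtain ⟨B, hB, hBk, him⟩ := ih G (S \ X) (hα.mono Finset.sdiff_subset le_rfl) (by omega)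
      have hW : 3 * k ≤ ((S \ X) \ B).card := by
        rw [Finset.card_sdiff_of_subset hB]
        omega
      have hs := five_sum (W := (S \ X) \ B) h5 hα (by
        intro w hw
        simp only [Finset.mem_sdiff, hX, not_or] at hw
        tauto)
      have hX1 := fun v => (hX v).trans (or_rot _ _ _ _ _)
      have hX2 := fun v => (hX1 v).trans (or_rot _ _ _ _ _)
      have hX3 := fun v => (hX2 v).trans (or_rot _ _ _ _ _)
      have hX4 := fun v => (hX3 v).trans (or_rot _ _ _ _ _)
      have r0 := fun h => hno (extend_two' h5 hα hX hB hBk him hW hclq h)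
      have r1 := fun h => hno (extend_two' h5.rot hα hX1 hB hBk him hW hclq h)
      have r2 := fun h => hno (extend_two' h5.rot.rot hα hX2 hB hBk him hW hclq h)
      have r3 := fun h => hno (extend_two' h5.rot.rot.rot hα hX3 hB hBk him hW hclq h)
      have r4 := fun h => hno (extend_two' h5.rot.rot.rot.rot hα hX4 hB hBk him hW hclq h)
      have r0 := not_le.1 r0
      have r1 := not_le.1 r1
      have r2 := not_le.1 r2
      have r3 := not_le.1 r3
      have r4 := not_le.1 r4
      omega

end CI

/-- Let `β 1 = 1`, `β 2 = 5/2`, and suppose that for every `i ≥ 3` we have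
`β i ≥ β (i-1) + 2` and `β i ≥ β s + β t + (2i-1)/i` whenever `s, t ∈ {2, …, i-2}`
with `s + t = i`.  Then every graph on `n` vertices with independence number at most
`α` contains an immersion of a clique on at least `⌊n / β α⌋ - 1` vertices. -/
theorem clique_immersion_of_indepNum_le (β : ℕ → ℚ)
    (hβ1 : β 1 = 1) (hβ2 : β 2 = 5 / 2)
    (hstep : ∀ i : ℕ, 3 ≤ i → β (i - 1) + 2 ≤ β i)
    (hsplit : ∀ i : ℕ, 3 ≤ i → ∀ s t : ℕ, 2 ≤ s → s ≤ i - 2 → 2 ≤ t → t ≤ i - 2 →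
      s + t = i → β s + β t + (2 * (i : ℚ) - 1) / (i : ℚ) ≤ β i)
    {V : Type*} [Fintype V] (G : SimpleGraph V) (n α : ℕ)
    (hn : Fintype.card V = n) (hα : 1 ≤ α)
    (hind : ∀ I : Finset V, (I : Set V).Pairwise (fun x y => ¬ G.Adj x y) → I.card ≤ α) :
    ∃ k : ℕ, ⌊(n : ℚ) / β α⌋ - 1 ≤ (k : ℤ) ∧ CliqueImmersion G k := by
  obtain ⟨hαβ, hmain⟩ := CI.main_general (G := G) β hβ1 hβ2 hstep hsplit
    (fun S k h1 h2 => CI.alpha_two k G S h1 h2) α hα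
  have hpos : (0 : ℚ) < β α := by
    have : (1 : ℚ) ≤ α := by exact_mod_cast hα
    linarith
  refine ⟨(⌊(n : ℚ) / β α⌋ - 1).toNat, Int.self_le_toNat _, ?_⟩
  by_cases h0 : ⌊(n : ℚ) / β α⌋ - 1 ≤ 0
  · rw [Int.toNat_of_nonpos h0]
    exact (CI.HasImm.zero (G := G) Finset.univ).toClique
  · apply CI.HasImm.toClique (S := Finset.univ)
    apply hmain
    · intro I _ hI
      exact hind I hI
    · rw [Finset.card_univ, hn]
      have h1 : (((⌊(n : ℚ) / β α⌋ - 1).toNat : ℕ) : ℚ) = ((⌊(n : ℚ) / β α⌋ - 1 : ℤ) : ℚ) := by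
        rw [← Int.cast_natCast, Int.toNat_of_nonneg (by omega)]
      rw [h1]
      have h2 := Int.floor_le ((n : ℚ) / β α)
      rw [le_div_iff₀ hpos] at h2
      push_cast
      linarith
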